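/- arXiv:2007.11138 — 2 statements merged into one kernel-verified Lean document; each statement's English description precedes it below -/
import Mathlib

section
/- Consider the Gaussian additive model with priors {P_N} and M_N → ∞. Suppose that for every t ∈ [0,1], limsup_{N→∞} (1/log M_N)·log P_N^{⊗2}[⟨X,X'⟩ ≥ t] ≤ −2t/(1+t), where X, X' are i.i.d. draws from P_N. Then {P_N} satisfies the all-or-nothing phenomenon with critical SNR λ_N = 2 log M_N. -/
open MeasureTheory ProbabilityTheory Filter Real
open scoped ENNReal NNReal

noncomputable section

/-- Vectors in `ℝ^N`. -/
abbrev V (N : ℕ) : Type := Fin N → ℝ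

/-- Euclidean inner product on `ℝ^N`. -/
def inp {N : ℕ} (x y : V N) : ℝ := ∑ i, x i * y i

/-- `S` is a subset of the unit sphere of `ℝ^N`. -/
def onSphere {N : ℕ} (S : Finset (V N)) : Prop := ∀ x ∈ S, ∑ i, (x i) ^ 2 = 1

/-- The standard Gaussian measure on `ℝ^N`. -/
def stdGaussian (N : ℕ) : Measure (V N) :=
  Measure.pi fun _ : Fin N => gaussianReal 0 1

/-- The uniform probability measure on a finite set of vectors. -/
def unifOn {N : ℕ} (S : Finset (V N)) : Measure (V N) :=
  (S.card : ℝ≥0∞)⁻¹ • ∑ x ∈ S, Measure.dirac x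

/-- The joint law of `(X, Y)` where `X` is uniform on `S`, `Z` is an independent standard
Gaussian vector, and `Y = √λ • X + Z`. -/
def jointLaw (N : ℕ) (S : Finset (V N)) (lam : ℝ) : Measure (V N × V N) :=
  ((unifOn S).prod (stdGaussian N)).map
    (fun q => (q.1, fun i => Real.sqrt lam * q.1 i + q.2 i))

/-- `Q N S lam` : the law of the observation `Y = √λ • X + Z`. -/
def Q (N : ℕ) (S : Finset (V N)) (lam : ℝ) : Measure (V N) :=
  (jointLaw N S lam).map Prod.snd

/-- Kullback–Leibler divergence `D(μ ‖ ν) = ∫ log (dμ/dν) dμ` (real-valued). -/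
def klReal {α : Type*} [MeasurableSpace α] (μ ν : Measure α) : ℝ :=
  ∫ x, Real.log (μ.rnDeriv ν x).toReal ∂μ

/-- The σ-algebra generated by the observation `Y` (the second coordinate). -/
def sigmaY (N : ℕ) : MeasurableSpace (V N × V N) :=
  MeasurableSpace.comap Prod.snd inferInstance

/-- The minimum mean squared error `E‖X - E[X | Y]‖²` at SNR `lam`. -/
def mmse (N : ℕ) (S : Finset (V N)) (lam : ℝ) : ℝ :=
  ∑ i : Fin N,
    ∫ ω, (ω.1 i - ((jointLaw N S lam)[fun ω' => ω'.1 i | sigmaY N]) ω) ^ 2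
      ∂(jointLaw N S lam)

/-- The all-or-nothing phenomenon with critical SNR sequence `lam`. -/
def allOrNothing (S : ∀ N : ℕ, Finset (V N)) (lam : ℕ → ℝ) : Prop :=
  (∀ β : ℝ, 0 ≤ β → β < 1 →
    Tendsto (fun N => mmse N (S N) (β * lam N)) atTop (nhds 1)) ∧
  (∀ β : ℝ, 1 < β →
    Tendsto (fun N => mmse N (S N) (β * lam N)) atTop (nhds 0))

/-- `limsup_N (1 / log M_N) · log P_N^{⊗2}[⟨X, X'⟩ ≥ t] ≤ c`, where `X, X'` are i.i.d.
draws from the uniform distribution on `S N`: for every `ε > 0`, eventually the probability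
that the overlap is at least `t` is at most `M_N ^ (c + ε)`. -/
def overlapRateLe (S : ∀ N : ℕ, Finset (V N)) (t c : ℝ) : Prop :=
  ∀ ε : ℝ, 0 < ε → ∀ᶠ N in atTop,
    ((unifOn (S N)).prod (unifOn (S N))) {q | t ≤ inp q.1 q.2}
      ≤ ((S N).card : ℝ≥0∞) ^ (c + ε)

/-- The spread assumption: `lim_{t→1⁻} limsup_N (1/log M_N) log P_N^{⊗2}[⟨X,X'⟩ ≥ t] ≤ -1`. -/
def spread (S : ∀ N : ℕ, Finset (V N)) : Prop :=
  ∀ ε : ℝ, 0 < ε → ∃ t₀ : ℝ, t₀ < 1 ∧ ∀ t : ℝ, t₀ < t → t < 1 →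
    overlapRateLe S t (-1 + ε)

/-! ## Gaussian preliminaries -/

/-- The likelihood ratio of `√λ x + Z` with respect to `Z` (with `b = √λ`, `‖x‖ = 1`). -/
def wt {N : ℕ} (b : ℝ) (x y : V N) : ℝ := Real.exp (b * inp x y - b ^ 2 / 2)

instance instProbStd (N : ℕ) : IsProbabilityMeasure (_root_.stdGaussian N) := by
  unfold _root_.stdGaussian; infer_instance

lemma measurable_inp_right {N : ℕ} (x : V N) : Measurable (fun y => inp x y) := by
  unfold inp; fun_prop

lemma measurable_wt {N : ℕ} (b : ℝ) (x : V N) : Measurable (fun y => wt b x y) := by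
  have := measurable_inp_right x
  unfold wt; fun_prop

lemma inp_self_of_sphere {N : ℕ} {S : Finset (V N)} (h : onSphere S) {x : V N} (hx : x ∈ S) :
    inp x x = 1 := by
  rw [← h x hx]; unfold inp; exact Finset.sum_congr rfl fun i _ => by ring

lemma exp_inp_eq_prod {N : ℕ} (v y : V N) : Real.exp (inp v y) = ∏ i, Real.exp (v i * y i) := by
  unfold inp; rw [Real.exp_sum]

lemma integrable_exp_inp {N : ℕ} (v : V N) :
    Integrable (fun y => Real.exp (inp v y)) (_root_.stdGaussian N) := by
  simp_rw [exp_inp_eq_prod]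
  exact Integrable.fintype_prod (f := fun i t => Real.exp (v i * t))
    (fun i => integrable_exp_mul_gaussianReal (v i))

lemma integral_exp_inp {N : ℕ} (v : V N) :
    ∫ y, Real.exp (inp v y) ∂(_root_.stdGaussian N) = Real.exp (inp v v / 2) := by
  simp_rw [exp_inp_eq_prod]
  unfold _root_.stdGaussian
  rw [integral_fintype_prod_eq_prod (f := fun i t => Real.exp (v i * t))]
  have : ∀ t : ℝ, ∫ x, Real.exp (t * x) ∂(gaussianReal 0 1) = Real.exp (t ^ 2 / 2) := by
    intro t
    have h := congrFun (mgf_id_gaussianReal (μ := 0) (v := 1)) t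
    simpa [mgf] using h
  simp_rw [this, ← Real.exp_sum]
  unfold inp
  rw [Finset.sum_div]
  congr 1
  exact Finset.sum_congr rfl fun i _ => by ring

lemma gaussianReal_shift (a : ℝ) (s : Set ℝ) (hs : MeasurableSet s) :
    gaussianReal a 1 s
      = ENNReal.ofReal (∫ t, s.indicator (fun t => Real.exp (a * t - a ^ 2 / 2)) t
          ∂(gaussianReal 0 1)) := by
  rw [gaussianReal_apply_eq_integral _ one_ne_zero, integral_gaussianReal_eq_integral_smul one_ne_zero,
    ← integral_indicator hs]
  congr 1
  refine integral_congr_ae (Eventually.of_forall fun t => ?_)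
  by_cases ht : t ∈ s
  · simp only [Set.indicator_of_mem ht, gaussianPDFReal, smul_eq_mul, mul_assoc, ← Real.exp_add]
    congr 3
    simp; ring
  · simp [Set.indicator_of_notMem ht]

lemma stdGaussian_shift {N : ℕ} (v : V N) :
    (_root_.stdGaussian N).map (fun z i => v i + z i)
      = (_root_.stdGaussian N).withDensity
          (fun y => ENNReal.ofReal (Real.exp (inp v y - inp v v / 2))) := by
  have h1 : (_root_.stdGaussian N).map (fun z i => v i + z i)
      = Measure.pi (fun i => gaussianReal (v i) 1) := by
    unfold _root_.stdGaussian
    rw [Measure.pi_map_pi (μ := fun _ : Fin N => gaussianReal 0 1) (f := fun i t => v i + t)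
      (fun i => by fun_prop)]
    congr 1; ext i : 1
    rw [gaussianReal_map_const_add]; simp
  rw [h1]
  refine Measure.pi_eq fun s hs => ?_
  have hm := measurable_inp_right v
  have hint : Integrable (fun y => Real.exp (inp v y - inp v v / 2)) (_root_.stdGaussian N) := by
    simp_rw [Real.exp_sub]
    exact (integrable_exp_inp v).div_const _
  have hS : MeasurableSet (Set.univ.pi s) := MeasurableSet.univ_pi hs
  rw [withDensity_apply _ hS, ← ofReal_integral_eq_lintegral_ofReal hint.integrableOn
    (Eventually.of_forall fun y => (Real.exp_pos _).le), ← integral_indicator hS]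
  have h2 : ∀ y : V N, (Set.univ.pi s).indicator (fun y => Real.exp (inp v y - inp v v / 2)) y
      = ∏ i, (s i).indicator (fun t => Real.exp (v i * t - (v i) ^ 2 / 2)) (y i) := by
    intro y
    by_cases hy : y ∈ Set.univ.pi s
    · rw [Set.indicator_of_mem hy]
      have : ∀ i, (s i).indicator (fun t => Real.exp (v i * t - (v i) ^ 2 / 2)) (y i)
          = Real.exp (v i * y i - (v i) ^ 2 / 2) := fun i =>
        Set.indicator_of_mem (hy i (Set.mem_univ i)) _
      simp_rw [this, ← Real.exp_sum]
      congr 1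
      unfold inp
      rw [Finset.sum_sub_distrib, Finset.sum_div]
      congr 1
      exact Finset.sum_congr rfl fun i _ => by ring
    · rw [Set.indicator_of_notMem hy]
      simp only [Set.mem_pi, not_forall] at hy
      obtain ⟨i, _, hi⟩ := hy
      exact (Finset.prod_eq_zero (Finset.mem_univ i) (Set.indicator_of_notMem hi _)).symm
  simp_rw [h2]
  unfold _root_.stdGaussian
  rw [integral_fintype_prod_eq_prod (f := fun i => (s i).indicator
    (fun t => Real.exp (v i * t - (v i) ^ 2 / 2))), ENNReal.ofReal_prod_of_nonneg]
  · exact Finset.prod_congr rfl fun i _ => (gaussianReal_shift _ _ (hs i)).symm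
  · intro i _
    exact integral_nonneg fun t => Set.indicator_nonneg (fun _ _ => (Real.exp_pos _).le) _

/-! ## The joint law -/

lemma unifOn_lintegral {N : ℕ} (S : Finset (V N)) (f : V N → ℝ≥0∞) (hf : Measurable f) :
    ∫⁻ x, f x ∂(unifOn S) = (S.card : ℝ≥0∞)⁻¹ * ∑ x ∈ S, f x := by
  unfold unifOn
  rw [lintegral_smul_measure, lintegral_finsetSum_measure]
  simp [lintegral_dirac' _ hf]

instance instSFiniteUnif {N : ℕ} (S : Finset (V N)) : SFinite (unifOn S) := by
  unfold unifOn; infer_instance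

lemma jointLaw_eq {N : ℕ} {S : Finset (V N)} (hS : onSphere S) (lam : ℝ) :
    jointLaw N S lam = (S.card : ℝ≥0∞)⁻¹ • ∑ x ∈ S,
      ((_root_.stdGaussian N).withDensity (fun y => ENNReal.ofReal (wt (√lam) x y))).map
        (fun y => (x, y)) := by
  ext T hT
  unfold jointLaw
  have hmeas : Measurable (fun q : V N × V N => (q.1, fun i => √lam * q.1 i + q.2 i)) := by
    fun_prop
  rw [Measure.map_apply hmeas hT, Measure.prod_apply (hmeas hT),
    unifOn_lintegral _ _ (measurable_measure_prodMk_left (hmeas hT))]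
  rw [Measure.smul_apply, Measure.finsetSum_apply, smul_eq_mul]
  congr 1
  refine Finset.sum_congr rfl fun x hx => ?_
  have hm : Measurable (fun y : V N => (x, y)) := by fun_prop
  rw [Measure.map_apply hm hT]
  have h := stdGaussian_shift (fun i => √lam * x i)
  have e : ∀ y, inp (fun i => √lam * x i) y = √lam * inp x y := by
    intro y; unfold inp; rw [Finset.mul_sum]; exact Finset.sum_congr rfl fun i _ => by ring
  have e2 : inp (fun i => √lam * x i) (fun i => √lam * x i) = √lam ^ 2 := by
    have : inp (fun i => √lam * x i) (fun i => √lam * x i) = √lam ^ 2 * inp x x := by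
      unfold inp; rw [Finset.mul_sum]; exact Finset.sum_congr rfl fun i _ => by ring
    rw [this, inp_self_of_sphere hS hx, mul_one]
  simp_rw [e2, e] at h
  unfold wt
  rw [← h, Measure.map_apply (by fun_prop) (hm hT)]
  rfl

lemma integrable_wt {N : ℕ} (b : ℝ) (x : V N) :
    Integrable (fun y => wt b x y) (_root_.stdGaussian N) := by
  have h := (integrable_exp_inp (fun i => b * x i)).div_const (Real.exp (b ^ 2 / 2))
  refine h.congr (Eventually.of_forall fun y => ?_)
  simp only [wt, Real.exp_sub]
  congr 2
  unfold inp; rw [Finset.mul_sum]; exact Finset.sum_congr rfl fun i _ => by ring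

lemma wt_pos {N : ℕ} (b : ℝ) (x y : V N) : 0 < wt b x y := Real.exp_pos _

lemma jointLaw_integral {N : ℕ} {S : Finset (V N)} (hS : onSphere S) (hne : S.Nonempty) (lam : ℝ)
    (F : V N × V N → ℝ) (hF : Measurable F)
    (hi : ∀ x ∈ S, Integrable (fun y => wt (√lam) x y * F (x, y)) (_root_.stdGaussian N)) :
    Integrable F (jointLaw N S lam) ∧ ∫ q, F q ∂(jointLaw N S lam)
      = (S.card : ℝ)⁻¹ * ∑ x ∈ S, ∫ y, wt (√lam) x y * F (x, y) ∂(_root_.stdGaussian N) := by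
  have hcard : (S.card : ℝ≥0∞) ≠ 0 := by
    simpa using hne.ne_empty
  have hw : ∀ x : V N, Measurable (fun y => ENNReal.ofReal (wt (√lam) x y)) := fun x =>
    (measurable_wt _ x).ennreal_ofReal
  have hm : ∀ x : V N, Measurable (fun y : V N => (x, y)) := fun x => by fun_prop
  have hint : ∀ x ∈ S, Integrable F
      (((_root_.stdGaussian N).withDensity (fun y => ENNReal.ofReal (wt (√lam) x y))).map
        (fun y => (x, y))) := by
    intro x hx
    rw [integrable_map_measure hF.aestronglyMeasurable (hm x).aemeasurable,
      integrable_withDensity_iff_integrable_smul' (hw x) (Eventually.of_forall fun _ => ENNReal.ofReal_lt_top)]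
    refine (hi x hx).congr (Eventually.of_forall fun y => ?_)
    simp [ENNReal.toReal_ofReal (wt_pos _ x y).le]
  rw [jointLaw_eq hS]
  constructor
  · exact (integrable_finsetSum_measure.2 hint).smul_measure (ENNReal.inv_ne_top.2 hcard)
  · rw [integral_smul_measure, integral_finsetSum_measure hint]
    simp only [ENNReal.toReal_inv, ENNReal.toReal_natCast, smul_eq_mul]
    congr 1
    refine Finset.sum_congr rfl fun x hx => ?_
    rw [integral_map (hm x).aemeasurable hF.aestronglyMeasurable,
      integral_withDensity_eq_integral_toReal_smul (hw x) (Eventually.of_forall fun _ => ENNReal.ofReal_lt_top)]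
    simp [ENNReal.toReal_ofReal (wt_pos _ x _).le]

/-! ## The posterior mean and the formula for the MMSE -/

/-- Total weight. -/
def tot {N : ℕ} (S : Finset (V N)) (b : ℝ) (y : V N) : ℝ := ∑ x ∈ S, wt b x y

/-- Posterior mean, coordinate `i`. -/
def pm {N : ℕ} (S : Finset (V N)) (b : ℝ) (i : Fin N) (y : V N) : ℝ :=
  (∑ x ∈ S, wt b x y * x i) / tot S b y

lemma tot_pos {N : ℕ} {S : Finset (V N)} (hne : S.Nonempty) (b : ℝ) (y : V N) : 0 < tot S b y :=
  Finset.sum_pos (fun x _ => wt_pos b x y) hne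

lemma measurable_tot {N : ℕ} (S : Finset (V N)) (b : ℝ) : Measurable (tot S b) := by
  unfold tot
  exact Finset.measurable_sum _ fun x _ => measurable_wt b x

lemma measurable_pm {N : ℕ} (S : Finset (V N)) (b : ℝ) (i : Fin N) : Measurable (pm S b i) := by
  unfold pm
  exact (Finset.measurable_sum _ fun x _ => (measurable_wt b x).mul_const _).div (measurable_tot S b)

lemma abs_coord_le {N : ℕ} {S : Finset (V N)} (hS : onSphere S) {x : V N} (hx : x ∈ S)
    (i : Fin N) : |x i| ≤ 1 := by
  have h := hS x hx
  have h2 : (x i) ^ 2 ≤ ∑ j, (x j) ^ 2 :=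
    Finset.single_le_sum (f := fun j => (x j) ^ 2) (fun j _ => sq_nonneg _) (Finset.mem_univ i)
  rw [h] at h2
  exact abs_le_one_iff_mul_self_le_one.2 (by nlinarith)

lemma abs_pm_le {N : ℕ} {S : Finset (V N)} (hS : onSphere S) (hne : S.Nonempty) (b : ℝ)
    (i : Fin N) (y : V N) : |pm S b i y| ≤ 1 := by
  unfold pm
  rw [abs_div, abs_of_pos (tot_pos hne b y), div_le_one (tot_pos hne b y)]
  refine (Finset.abs_sum_le_sum_abs _ _).trans ?_
  unfold tot
  refine Finset.sum_le_sum fun x hx => ?_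
  rw [abs_mul, abs_of_pos (wt_pos b x y)]
  exact mul_le_of_le_one_right (wt_pos b x y).le (abs_coord_le hS hx i)

lemma integrable_wt_mul {N : ℕ} (b : ℝ) (x : V N) (f : V N → ℝ) (hf : Measurable f) (C : ℝ)
    (hC : ∀ y, |f y| ≤ C) : Integrable (fun y => wt b x y * f y) (_root_.stdGaussian N) := by
  refine ((integrable_wt b x).mul_const C).mono'
    ((measurable_wt b x).mul hf).aestronglyMeasurable (Eventually.of_forall fun y => ?_)
  rw [Real.norm_eq_abs, abs_mul, abs_of_pos (wt_pos b x y)]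
  exact mul_le_mul_of_nonneg_left (hC y) (wt_pos b x y).le

lemma jointLaw_prob {N : ℕ} {S : Finset (V N)} (hne : S.Nonempty) (lam : ℝ) :
    IsProbabilityMeasure (jointLaw N S lam) := by
  have : IsProbabilityMeasure (unifOn S) := by
    constructor
    have := unifOn_lintegral S (fun _ => 1) measurable_const
    rw [lintegral_one] at this
    rw [this]
    simp only [Finset.sum_const, nsmul_eq_mul, mul_one]
    exact ENNReal.inv_mul_cancel (by simpa using hne.ne_empty) (by simp)
  unfold jointLaw
  exact Measure.isProbabilityMeasure_map (by fun_prop)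

lemma sigmaY_le (N : ℕ) : sigmaY N ≤ (inferInstance : MeasurableSpace (V N × V N)) :=
  measurable_snd.comap_le

lemma condExp_eq {N : ℕ} {S : Finset (V N)} (hS : onSphere S) (hne : S.Nonempty) (lam : ℝ)
    (i : Fin N) :
    (fun ω : V N × V N => pm S (√lam) i ω.2) =ᵐ[jointLaw N S lam]
      (jointLaw N S lam)[fun ω' => ω'.1 i | sigmaY N] := by
  have hP := jointLaw_prob hne lam
  set b := √lam with hb
  have hpm := measurable_pm S b i
  have hpm2 : Measurable (fun ω : V N × V N => pm S b i ω.2) := hpm.comp measurable_snd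
  have hxm : Measurable (fun ω : V N × V N => ω.1 i) := by fun_prop
  have hXint : Integrable (fun ω' : V N × V N => ω'.1 i) (jointLaw N S lam) :=
    (jointLaw_integral hS hne lam _ hxm fun x hx =>
      integrable_wt_mul _ x _ measurable_const 1 fun _ => abs_coord_le hS hx i).1
  have hmint : Integrable (fun ω : V N × V N => pm S b i ω.2) (jointLaw N S lam) :=
    (jointLaw_integral hS hne lam _ hpm2 fun x hx =>
      integrable_wt_mul _ x _ hpm 1 fun y => abs_pm_le hS hne b i y).1
  refine ae_eq_condExp_of_forall_setIntegral_eq (sigmaY_le N) hXint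
    (fun s _ _ => hmint.integrableOn) ?_ ?_
  · rintro s ⟨T, hT, rfl⟩ -
    have hsT : MeasurableSet (Prod.snd ⁻¹' T : Set (V N × V N)) := measurable_snd hT
    rw [← integral_indicator hsT, ← integral_indicator hsT]
    have i1 : ∀ x ∈ S, Integrable (fun y => wt b x y * T.indicator (pm S b i) y)
        (_root_.stdGaussian N) := fun x hx =>
      integrable_wt_mul _ x _ (hpm.indicator hT) 1 fun y => by
        by_cases hy : y ∈ T
        · rw [Set.indicator_of_mem hy]; exact abs_pm_le hS hne b i y
        · rw [Set.indicator_of_notMem hy]; simp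
    have i2 : ∀ x ∈ S, Integrable (fun y => wt b x y * T.indicator (fun _ => x i) y)
        (_root_.stdGaussian N) := fun x hx =>
      integrable_wt_mul _ x _ (measurable_const.indicator hT) 1 fun y => by
        by_cases hy : y ∈ T
        · rw [Set.indicator_of_mem hy]; exact abs_coord_le hS hx i
        · rw [Set.indicator_of_notMem hy]; simp
    rw [(jointLaw_integral hS hne lam _ (hpm2.indicator hsT) i1).2,
      (jointLaw_integral hS hne lam _ (hxm.indicator hsT) i2).2]
    congr 1
    suffices key : ∫ y, ∑ x ∈ S, wt b x y * T.indicator (pm S b i) y ∂(_root_.stdGaussian N)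
        = ∫ y, ∑ x ∈ S, wt b x y * T.indicator (fun _ => x i) y ∂(_root_.stdGaussian N) by
      exact (integral_finsetSum S i1).symm.trans (key.trans (integral_finsetSum S i2))
    congr 1
    ext y
    by_cases hy : y ∈ T
    · simp only [Set.indicator_of_mem hy]
      rw [← Finset.sum_mul]
      unfold pm
      exact mul_div_cancel₀ _ (tot_pos hne b y).ne'
    · simp [Set.indicator_of_notMem hy]
  · have : Measurable[sigmaY N] (fun ω : V N × V N => pm S b i ω.2) :=
      hpm.comp (comap_measurable Prod.snd)
    exact this.stronglyMeasurable.aestronglyMeasurable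

lemma variance_algebra {N : ℕ} {S : Finset (V N)} (hS : onSphere S) (hne : S.Nonempty) (b : ℝ)
    (y : V N) :
    ∑ x ∈ S, ∑ i, wt b x y * (x i - pm S b i y) ^ 2
      = ∑ x ∈ S, ∑ x' ∈ S, (1 - inp x x') * (wt b x y * wt b x' y / tot S b y) := by
  have hA := (tot_pos hne b y).ne'
  have h1 : ∀ i, ∑ x ∈ S, wt b x y * (x i - pm S b i y) ^ 2
      = ∑ x ∈ S, wt b x y * (x i) ^ 2 - (∑ x ∈ S, wt b x y * x i) ^ 2 / tot S b y := by
    intro i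
    have e : ∀ x, wt b x y * (x i - pm S b i y) ^ 2 = wt b x y * (x i) ^ 2
        - 2 * pm S b i y * (wt b x y * x i) + (pm S b i y) ^ 2 * wt b x y := fun x => by ring
    simp_rw [e, Finset.sum_add_distrib, Finset.sum_sub_distrib, ← Finset.mul_sum]
    have : ∑ x ∈ S, wt b x y = tot S b y := rfl
    rw [this]
    unfold pm
    field_simp
    ring
  rw [Finset.sum_comm, Finset.sum_congr rfl fun i _ => h1 i, Finset.sum_sub_distrib,
    Finset.sum_comm]
  have h2 : ∑ x ∈ S, ∑ i, wt b x y * (x i) ^ 2 = tot S b y := by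
    unfold tot
    refine Finset.sum_congr rfl fun x hx => ?_
    rw [← Finset.mul_sum, hS x hx, mul_one]
  have h3 : ∑ x ∈ S, ∑ x' ∈ S, wt b x y * wt b x' y / tot S b y = tot S b y := by
    simp_rw [← Finset.sum_div, ← Finset.mul_sum, ← Finset.sum_mul]
    exact mul_div_cancel_right₀ _ hA
  have h4 : ∑ x ∈ S, ∑ x' ∈ S, inp x x' * (wt b x y * wt b x' y / tot S b y)
      = ∑ i, (∑ x ∈ S, wt b x y * x i) ^ 2 / tot S b y := by
    simp_rw [sq, Finset.sum_mul_sum, Finset.sum_div]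
    symm
    rw [Finset.sum_comm]
    refine Finset.sum_congr rfl fun x _ => ?_
    rw [Finset.sum_comm]
    refine Finset.sum_congr rfl fun x' _ => ?_
    unfold inp
    rw [Finset.sum_mul]
    exact Finset.sum_congr rfl fun i _ => by ring
  simp_rw [sub_mul, Finset.sum_sub_distrib, one_mul]
  rw [h2, h3, h4]

lemma ww_le {N : ℕ} {S : Finset (V N)} (b : ℝ) {x' : V N} (x : V N) (hx' : x' ∈ S) (y : V N) :
    wt b x y * wt b x' y / tot S b y ≤ wt b x y := by
  have hA : 0 < tot S b y := tot_pos ⟨x', hx'⟩ b y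
  rw [div_le_iff₀ hA]
  refine mul_le_mul_of_nonneg_left ?_ (wt_pos b x y).le
  exact Finset.single_le_sum (f := fun x => wt b x y) (fun x _ => (wt_pos b x y).le) hx'

lemma integrable_ww {N : ℕ} {S : Finset (V N)} (b : ℝ) {x' : V N} (x : V N) (hx' : x' ∈ S) :
    Integrable (fun y => wt b x y * wt b x' y / tot S b y) (_root_.stdGaussian N) := by
  refine (integrable_wt b x).mono' (((measurable_wt b x).mul (measurable_wt b x')).div
    (measurable_tot S b)).aestronglyMeasurable (Eventually.of_forall fun y => ?_)
  have hA : 0 < tot S b y := tot_pos ⟨x', hx'⟩ b y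
  have := wt_pos b x y
  have := wt_pos b x' y
  rw [Real.norm_eq_abs, abs_of_nonneg (by positivity)]
  exact ww_le b x hx' y

lemma mmse_eq {N : ℕ} {S : Finset (V N)} (hS : onSphere S) (hne : S.Nonempty) (lam : ℝ) :
    mmse N S lam = (S.card : ℝ)⁻¹ * ∫ y, ∑ x ∈ S, ∑ x' ∈ S,
      (1 - inp x x') * (wt (√lam) x y * wt (√lam) x' y / tot S (√lam) y)
        ∂(_root_.stdGaussian N) := by
  unfold mmse
  set b := √lam with hb
  have hi : ∀ i, ∀ x ∈ S, Integrable (fun y => wt b x y * (x i - pm S b i y) ^ 2)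
      (_root_.stdGaussian N) := by
    intro i x hx
    refine integrable_wt_mul _ x _ (((measurable_pm S b i).const_sub _).pow_const 2) 4 fun y => ?_
    have h1 := abs_le.1 (abs_coord_le hS hx i)
    have h2 := abs_le.1 (abs_pm_le hS hne b i y)
    rw [abs_of_nonneg (sq_nonneg _)]
    nlinarith
  have h1 : ∀ i : Fin N, ∫ ω, (ω.1 i - ((jointLaw N S lam)[fun ω' => ω'.1 i | sigmaY N]) ω) ^ 2
      ∂(jointLaw N S lam)
      = (S.card : ℝ)⁻¹ * ∑ x ∈ S, ∫ y, wt b x y * (x i - pm S b i y) ^ 2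
          ∂(_root_.stdGaussian N) := by
    intro i
    have hmF : Measurable (fun ω : V N × V N => (ω.1 i - pm S b i ω.2) ^ 2) := by
      have h1 : Measurable (fun ω : V N × V N => ω.1 i) := by fun_prop
      exact (h1.sub ((measurable_pm S b i).comp measurable_snd)).pow_const 2
    rw [← (jointLaw_integral hS hne lam (fun ω => (ω.1 i - pm S b i ω.2) ^ 2) hmF (hi i)).2]
    refine integral_congr_ae ?_
    filter_upwards [condExp_eq hS hne lam i] with ω hω
    rw [← hω]
  rw [Finset.sum_congr rfl fun i _ => h1 i, ← Finset.mul_sum, Finset.sum_comm]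
  congr 1
  simp_rw [← variance_algebra hS hne]
  rw [integral_finsetSum S fun x hx => integrable_finsetSum _ fun i _ => hi i x hx]
  refine Finset.sum_congr rfl fun x hx => ?_
  rw [integral_finsetSum _ fun i _ => hi i x hx]

/-! ## Bounds for a fixed dimension -/

/-- The exponent function `2r/(1+r)` evaluated at the positive part of the overlap. -/
def gg (r : ℝ) : ℝ := 2 * r / (1 + r)

lemma inp_comb {N : ℕ} (c : ℝ) (x x' y : V N) :
    inp (fun i => c * (x i + x' i)) y = c * (inp x y + inp x' y) := by
  unfold inp
  rw [← Finset.sum_add_distrib, Finset.mul_sum]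
  exact Finset.sum_congr rfl fun i _ => by ring

lemma inp_comb_self {N : ℕ} (c : ℝ) (x x' : V N) (hx : inp x x = 1) (hx' : inp x' x' = 1) :
    inp (fun i => c * (x i + x' i)) (fun i => c * (x i + x' i)) = c ^ 2 * (2 + 2 * inp x x') := by
  have : inp (fun i => c * (x i + x' i)) (fun i => c * (x i + x' i))
      = c ^ 2 * (inp x x + inp x' x' + 2 * inp x x') := by
    unfold inp
    rw [Finset.mul_sum, ← Finset.sum_add_distrib, ← Finset.sum_add_distrib, Finset.mul_sum]
    exact Finset.sum_congr rfl fun i _ => by ring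
  rw [this, hx, hx']; ring

lemma abs_inp_le {N : ℕ} {x x' : V N} (hx : inp x x = 1) (hx' : inp x' x' = 1) :
    |inp x x'| ≤ 1 := by
  have h := Finset.sum_mul_sq_le_sq_mul_sq Finset.univ x x'
  have e1 : ∑ i, x i ^ 2 = 1 := by
    rw [← hx]; unfold inp; exact Finset.sum_congr rfl fun i _ => by ring
  have e2 : ∑ i, x' i ^ 2 = 1 := by
    rw [← hx']; unfold inp; exact Finset.sum_congr rfl fun i _ => by ring
  rw [e1, e2] at h
  have h' : inp x x' ^ 2 ≤ 1 := by simpa [inp] using h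
  exact abs_le_one_iff_mul_self_le_one.2 (by nlinarith)

lemma pair_mgf {N : ℕ} (c e : ℝ) {x x' : V N} (hx : inp x x = 1) (hx' : inp x' x' = 1) :
    Integrable (fun y => Real.exp (c * (inp x y + inp x' y) + e)) (_root_.stdGaussian N) ∧
    ∫ y, Real.exp (c * (inp x y + inp x' y) + e) ∂(_root_.stdGaussian N)
      = Real.exp (c ^ 2 * (1 + inp x x') + e) := by
  simp_rw [Real.exp_add _ e, ← inp_comb]
  refine ⟨(integrable_exp_inp _).mul_const _, ?_⟩
  rw [integral_mul_const, integral_exp_inp, inp_comb_self c x x' hx hx']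
  congr 2; ring

lemma single_mgf {N : ℕ} (c e : ℝ) {x : V N} (hx : inp x x = 1) :
    Integrable (fun y => Real.exp (c * inp x y + e)) (_root_.stdGaussian N) ∧
    ∫ y, Real.exp (c * inp x y + e) ∂(_root_.stdGaussian N) = Real.exp (c ^ 2 / 2 + e) := by
  have h := pair_mgf (c / 2) e hx hx
  have e1 : ∀ y, c / 2 * (inp x y + inp x y) + e = c * inp x y + e := fun y => by ring
  simp_rw [e1] at h
  refine ⟨h.1, h.2.trans ?_⟩
  rw [hx]; congr 1; ring

lemma tail_mgf {N : ℕ} (B k u : ℝ) {x : V N} (hx : inp x x = 1) :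
    Integrable (fun y => wt B x y * Real.exp (k * (inp x y - u))) (_root_.stdGaussian N) ∧
    ∫ y, wt B x y * Real.exp (k * (inp x y - u)) ∂(_root_.stdGaussian N)
      = Real.exp ((B + k) ^ 2 / 2 - B ^ 2 / 2 - k * u) := by
  have e1 : ∀ y, wt B x y * Real.exp (k * (inp x y - u))
      = Real.exp ((B + k) * inp x y + (- B ^ 2 / 2 - k * u)) := by
    intro y; unfold wt; rw [← Real.exp_add]; congr 1; ring
  simp_rw [e1]
  have h := single_mgf (B + k) (- B ^ 2 / 2 - k * u) hx
  refine ⟨h.1, h.2.trans ?_⟩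
  congr 1; ring

lemma sum_fst {N : ℕ} {S : Finset (V N)} (hne : S.Nonempty) (B : ℝ) (y : V N) (E : V N → ℝ)
    (hE : ∀ x, 0 ≤ E x) {D : Finset (V N × V N)} (hD : D ⊆ S ×ˢ S) :
    ∑ p ∈ D, wt B p.1 y * wt B p.2 y / tot S B y * E p.1 ≤ ∑ x ∈ S, wt B x y * E x := by
  have hA := tot_pos hne B y
  refine (Finset.sum_le_sum_of_subset_of_nonneg hD fun p _ _ => ?_).trans_eq ?_
  · have := wt_pos B p.1 y
    have := wt_pos B p.2 y
    have := hE p.1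
    positivity
  · rw [Finset.sum_product]
    refine Finset.sum_congr rfl fun x _ => ?_
    simp only
    rw [← Finset.sum_mul, ← Finset.sum_div, ← Finset.mul_sum]
    change wt B x y * tot S B y / tot S B y * E x = _
    rw [mul_div_cancel_right₀ _ hA.ne']

lemma sum_snd {N : ℕ} {S : Finset (V N)} (hne : S.Nonempty) (B : ℝ) (y : V N) (E : V N → ℝ)
    (hE : ∀ x, 0 ≤ E x) {D : Finset (V N × V N)} (hD : D ⊆ S ×ˢ S) :
    ∑ p ∈ D, wt B p.1 y * wt B p.2 y / tot S B y * E p.2 ≤ ∑ x ∈ S, wt B x y * E x := by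
  have hA := tot_pos hne B y
  refine (Finset.sum_le_sum_of_subset_of_nonneg hD fun p _ _ => ?_).trans_eq ?_
  · have := wt_pos B p.1 y
    have := wt_pos B p.2 y
    have := hE p.2
    positivity
  · rw [Finset.sum_product_right]
    refine Finset.sum_congr rfl fun x _ => ?_
    simp only
    rw [← Finset.sum_mul, ← Finset.sum_div, ← Finset.sum_mul]
    change tot S B y * wt B x y / tot S B y * E x = _
    rw [mul_div_cancel_left₀ _ (ne_of_gt hA)]

/-- Posterior mass of a set of pairs. -/
def kmass {N : ℕ} (S : Finset (V N)) (B : ℝ) (D : Finset (V N × V N)) : ℝ :=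
  (S.card : ℝ)⁻¹ * ∫ y, ∑ p ∈ D, wt B p.1 y * wt B p.2 y / tot S B y ∂(_root_.stdGaussian N)

lemma tails_sum {N : ℕ} {S : Finset (V N)} (hS : onSphere S) (B k u : ℝ)
    (hku : (B + k) ^ 2 / 2 - B ^ 2 / 2 - k * u = - k ^ 2 / 2) :
    Integrable (fun y => ∑ x ∈ S, wt B x y * Real.exp (k * (inp x y - u))) (_root_.stdGaussian N) ∧
    ∫ y, ∑ x ∈ S, wt B x y * Real.exp (k * (inp x y - u)) ∂(_root_.stdGaussian N)
      = S.card * Real.exp (- k ^ 2 / 2) := by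
  have h : ∀ x ∈ S, _ := fun x hx => tail_mgf B k u (inp_self_of_sphere hS hx)
  refine ⟨integrable_finsetSum _ fun x hx => (h x hx).1, ?_⟩
  rw [integral_finsetSum _ fun x hx => (h x hx).1, Finset.sum_congr rfl fun x hx => (h x hx).2, hku]
  simp

lemma kmass_bound1 {N : ℕ} {S : Finset (V N)} (hS : onSphere S) (hne : S.Nonempty) (B κ : ℝ)
    (hB : 0 ≤ B) (hκ : 0 ≤ κ) {D : Finset (V N × V N)} (hD : D ⊆ S ×ˢ S) :
    kmass S B D ≤ (S.card : ℝ)⁻¹ * ∑ p ∈ D,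
        Real.exp (-(B ^ 2 / 2) * (1 - gg (max (inp p.1 p.2) 0)) + B * κ)
      + 2 * Real.exp (- κ ^ 2 / 2) := by
  have hM : (0 : ℝ) < S.card := by exact_mod_cast hne.card_pos
  -- main term
  let c : V N × V N → ℝ := fun p => B / (1 + max (inp p.1 p.2) 0)
  let f : V N × V N → V N → ℝ := fun p y => Real.exp (c p * (inp p.1 y + inp p.2 y)
    + (- B ^ 2 / 2 + c p * max (inp p.1 p.2) 0 * (B + κ) - c p * (B - κ)))
  have hsp : ∀ p ∈ D, inp p.1 p.1 = 1 ∧ inp p.2 p.2 = 1 := fun p hp => by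
    have := Finset.mem_product.1 (hD hp)
    exact ⟨inp_self_of_sphere hS this.1, inp_self_of_sphere hS this.2⟩
  have hf : ∀ p ∈ D, Integrable (f p) (_root_.stdGaussian N) ∧
      ∫ y, f p y ∂(_root_.stdGaussian N)
        ≤ Real.exp (-(B ^ 2 / 2) * (1 - gg (max (inp p.1 p.2) 0)) + B * κ) := by
    intro p hp
    obtain ⟨h1, h2⟩ := hsp p hp
    have h := pair_mgf (c p)
      (- B ^ 2 / 2 + c p * max (inp p.1 p.2) 0 * (B + κ) - c p * (B - κ)) h1 h2
    refine ⟨h.1, h.2.trans_le (Real.exp_le_exp.2 ?_)⟩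
    set r := max (inp p.1 p.2) 0 with hr
    have hr0 : 0 ≤ r := le_max_right _ _
    have hr1 : inp p.1 p.2 ≤ r := le_max_left _ _
    have hle : c p ^ 2 * (1 + inp p.1 p.2) ≤ c p ^ 2 * (1 + r) :=
      mul_le_mul_of_nonneg_left (by linarith) (sq_nonneg _)
    have heq : c p ^ 2 * (1 + r) + (- B ^ 2 / 2 + c p * r * (B + κ) - c p * (B - κ))
        = -(B ^ 2 / 2) * (1 - gg r) + B * κ := by
      have : (1 + r) ≠ 0 := by positivity
      simp only [c, gg, ← hr]
      field_simp
      ring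
    linarith
  have ht1 := tails_sum hS B κ (B + κ) (by ring)
  have ht2 := tails_sum hS B (-κ) (B - κ) (by ring)
  have hpt : ∀ y, ∑ p ∈ D, wt B p.1 y * wt B p.2 y / tot S B y ≤
      ∑ p ∈ D, f p y + ∑ x ∈ S, wt B x y * Real.exp (κ * (inp x y - (B + κ)))
        + ∑ x ∈ S, wt B x y * Real.exp (-κ * (inp x y - (B - κ))) := by
    intro y
    have s1 := sum_fst hne B y (fun x => Real.exp (κ * (inp x y - (B + κ))))
      (fun x => (Real.exp_pos _).le) hD
    have s2 := sum_snd hne B y (fun x => Real.exp (-κ * (inp x y - (B - κ))))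
      (fun x => (Real.exp_pos _).le) hD
    refine le_trans ?_ (add_le_add_three le_rfl s1 s2)
    rw [← Finset.sum_add_distrib, ← Finset.sum_add_distrib]
    refine Finset.sum_le_sum fun p hp => ?_
    have hp2 := (Finset.mem_product.1 (hD hp)).2
    have hA := tot_pos hne B y
    have hw1 := wt_pos B p.1 y
    have hw2 := wt_pos B p.2 y
    have hq : 0 < wt B p.1 y * wt B p.2 y / tot S B y := by positivity
    have e1 := Real.exp_pos (κ * (inp p.1 y - (B + κ)))
    have e2 := Real.exp_pos (-κ * (inp p.2 y - (B - κ)))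
    have e3 : 0 < f p y := Real.exp_pos _
    by_cases c1 : inp p.1 y ≤ B + κ
    · by_cases c2 : B - κ ≤ inp p.2 y
      · have : wt B p.1 y * wt B p.2 y / tot S B y ≤ f p y := by
          refine (ww_le B p.1 hp2 y).trans (Real.exp_le_exp.2 ?_)
          set r := max (inp p.1 p.2) 0 with hr
          have hr0 : 0 ≤ r := le_max_right _ _
          have hc : 0 ≤ c p := by simp only [c, ← hr]; positivity
          have hcB : c p * (1 + r) = B := by
            simp only [c, ← hr]; field_simp
          have k1 : 0 ≤ c p * r * (B + κ - inp p.1 y) := by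
            have : 0 ≤ B + κ - inp p.1 y := by linarith
            positivity
          have k2 : 0 ≤ c p * (inp p.2 y - (B - κ)) := by
            have : 0 ≤ inp p.2 y - (B - κ) := by linarith
            positivity
          have k3 : B * inp p.1 y = c p * inp p.1 y + c p * r * inp p.1 y := by
            rw [← hcB]; ring
          rw [k3]
          linarith
        have := mul_pos hq e1
        have := mul_pos hq e2
        linarith
      · have : 1 ≤ Real.exp (-κ * (inp p.2 y - (B - κ))) := by
          apply Real.one_le_exp
          push Not at c2
          nlinarith
        have := le_mul_of_one_le_right hq.le this
        have := mul_pos hq e1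
        linarith
    · have : 1 ≤ Real.exp (κ * (inp p.1 y - (B + κ))) := by
        apply Real.one_le_exp
        push Not at c1
        exact mul_nonneg hκ (by linarith)
      have := le_mul_of_one_le_right hq.le this
      have := mul_pos hq e2
      linarith
  have hIf : Integrable (fun y => ∑ p ∈ D, f p y) (_root_.stdGaussian N) :=
    integrable_finsetSum _ fun p hp => (hf p hp).1
  have hmono := integral_mono (μ := _root_.stdGaussian N)
    (integrable_finsetSum D fun p hp => integrable_ww B p.1 (Finset.mem_product.1 (hD hp)).2)
    ((hIf.add ht1.1).add ht2.1) hpt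
  have hsplit : ∫ y, (∑ p ∈ D, f p y + ∑ x ∈ S, wt B x y * Real.exp (κ * (inp x y - (B + κ)))
        + ∑ x ∈ S, wt B x y * Real.exp (-κ * (inp x y - (B - κ)))) ∂(_root_.stdGaussian N)
      = ∑ p ∈ D, ∫ y, f p y ∂(_root_.stdGaussian N) + S.card * Real.exp (- κ ^ 2 / 2)
        + S.card * Real.exp (- κ ^ 2 / 2) := by
    refine (integral_add' (hIf.add ht1.1) ht2.1).trans ?_
    rw [integral_add' hIf ht1.1, ht1.2, ht2.2,
      integral_finsetSum _ fun p hp => (hf p hp).1]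
    simp
  have hmono2 := hmono.trans_eq hsplit
  have hfin := Finset.sum_le_sum fun p hp => (hf p hp).2
  unfold kmass
  calc _ ≤ (S.card : ℝ)⁻¹ * (∑ p ∈ D,
        Real.exp (-(B ^ 2 / 2) * (1 - gg (max (inp p.1 p.2) 0)) + B * κ)
        + S.card * Real.exp (- κ ^ 2 / 2) + S.card * Real.exp (- κ ^ 2 / 2)) :=
        mul_le_mul_of_nonneg_left (by linarith) (by positivity)
    _ = _ := by field_simp; ring

lemma kmass_bound2 {N : ℕ} {S : Finset (V N)} (hS : onSphere S) (hne : S.Nonempty) (B κ T : ℝ)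
    (hB : 0 ≤ B) (hκ : 0 ≤ κ) (hT : 0 < T) {D : Finset (V N × V N)} (hD : D ⊆ S ×ˢ S)
    (hD0 : ∀ p ∈ D, 0 ≤ inp p.1 p.2) :
    kmass S B D ≤ (S.card : ℝ)⁻¹ * T * ∑ p ∈ D,
        Real.exp ((B ^ 2 / 2 + B * κ) * gg (inp p.1 p.2))
      + 2 * Real.exp (- κ ^ 2 / 2) + (S.card : ℝ)⁻¹ * T⁻¹ := by
  have hM : (0 : ℝ) < S.card := by exact_mod_cast hne.card_pos
  let a : V N × V N → ℝ := fun p => B * inp p.1 p.2 / (1 + inp p.1 p.2)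
  let f : V N × V N → V N → ℝ := fun p y => Real.exp ((B - a p) * (inp p.1 y + inp p.2 y)
    + (- B ^ 2 + 2 * a p * (B + κ)))
  have hsp : ∀ p ∈ D, inp p.1 p.1 = 1 ∧ inp p.2 p.2 = 1 := fun p hp => by
    have := Finset.mem_product.1 (hD hp)
    exact ⟨inp_self_of_sphere hS this.1, inp_self_of_sphere hS this.2⟩
  have hf : ∀ p ∈ D, Integrable (f p) (_root_.stdGaussian N) ∧
      ∫ y, f p y ∂(_root_.stdGaussian N)
        = Real.exp ((B ^ 2 / 2 + B * κ) * gg (inp p.1 p.2)) := by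
    intro p hp
    obtain ⟨h1, h2⟩ := hsp p hp
    have h := pair_mgf (B - a p) (- B ^ 2 + 2 * a p * (B + κ)) h1 h2
    refine ⟨h.1, h.2.trans (congrArg _ ?_)⟩
    have hr0 := hD0 p hp
    have : (1 + inp p.1 p.2) ≠ 0 := by positivity
    simp only [a, gg]
    field_simp
    ring
  have ht1 := tails_sum hS B κ (B + κ) (by ring)
  have hpt : ∀ y, ∑ p ∈ D, wt B p.1 y * wt B p.2 y / tot S B y ≤
      T * ∑ p ∈ D, f p y + ∑ x ∈ S, wt B x y * Real.exp (κ * (inp x y - (B + κ)))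
        + ∑ x ∈ S, wt B x y * Real.exp (κ * (inp x y - (B + κ))) + T⁻¹ := by
    intro y
    have hA := tot_pos hne B y
    have s1 := sum_fst hne B y (fun x => Real.exp (κ * (inp x y - (B + κ))))
      (fun x => (Real.exp_pos _).le) hD
    have s2 := sum_snd hne B y (fun x => Real.exp (κ * (inp x y - (B + κ))))
      (fun x => (Real.exp_pos _).le) hD
    have s3 : ∑ p ∈ D, wt B p.1 y * wt B p.2 y / tot S B y * (T⁻¹ / tot S B y) ≤ T⁻¹ := by
      refine (sum_fst hne B y (fun _ => T⁻¹ / tot S B y) (fun _ => by positivity) hD).trans_eq ?_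
      rw [← Finset.sum_mul]
      exact mul_div_cancel₀ _ hA.ne'
    refine le_trans ?_ (add_le_add (add_le_add_three le_rfl s1 s2) s3)
    rw [Finset.mul_sum, ← Finset.sum_add_distrib, ← Finset.sum_add_distrib,
      ← Finset.sum_add_distrib]
    refine Finset.sum_le_sum fun p hp => ?_
    have hw1 := wt_pos B p.1 y
    have hw2 := wt_pos B p.2 y
    have hq : 0 < wt B p.1 y * wt B p.2 y / tot S B y := by positivity
    have e1 := mul_pos hq (Real.exp_pos (κ * (inp p.1 y - (B + κ))))
    have e2 := mul_pos hq (Real.exp_pos (κ * (inp p.2 y - (B + κ))))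
    have e3 : 0 < T * f p y := mul_pos hT (Real.exp_pos _)
    have e4 : 0 < wt B p.1 y * wt B p.2 y / tot S B y * (T⁻¹ / tot S B y) := by positivity
    by_cases c1 : inp p.1 y ≤ B + κ
    · by_cases c2 : inp p.2 y ≤ B + κ
      · by_cases c3 : T⁻¹ ≤ tot S B y
        · have h1 : wt B p.1 y * wt B p.2 y ≤ f p y := by
            unfold wt
            rw [← Real.exp_add]
            refine Real.exp_le_exp.2 ?_
            have hr0 := hD0 p hp
            have ha : 0 ≤ a p := by simp only [a]; positivity
            nlinarith [mul_nonneg ha (sub_nonneg.2 c1), mul_nonneg ha (sub_nonneg.2 c2)]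
          have h2 : wt B p.1 y * wt B p.2 y / tot S B y ≤ T * f p y := by
            rw [div_le_iff₀ hA]
            have h3 : 1 ≤ T * tot S B y := by
              rwa [inv_le_iff_one_le_mul₀' hT] at c3
            have hf0 : 0 < f p y := Real.exp_pos _
            nlinarith
          linarith
        · push Not at c3
          have : 1 ≤ T⁻¹ / tot S B y := by rw [le_div_iff₀ hA]; linarith
          have := le_mul_of_one_le_right hq.le this
          linarith
      · have : 1 ≤ Real.exp (κ * (inp p.2 y - (B + κ))) := by
          apply Real.one_le_exp
          push Not at c2
          exact mul_nonneg hκ (by linarith)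
        have := le_mul_of_one_le_right hq.le this
        linarith
    · have : 1 ≤ Real.exp (κ * (inp p.1 y - (B + κ))) := by
        apply Real.one_le_exp
        push Not at c1
        exact mul_nonneg hκ (by linarith)
      have := le_mul_of_one_le_right hq.le this
      linarith
  have hIf : Integrable (fun y => T * ∑ p ∈ D, f p y) (_root_.stdGaussian N) :=
    (integrable_finsetSum _ fun p hp => (hf p hp).1).const_mul T
  have hmono := integral_mono (μ := _root_.stdGaussian N)
    (integrable_finsetSum D fun p hp => integrable_ww B p.1 (Finset.mem_product.1 (hD hp)).2)
    (((hIf.add ht1.1).add ht1.1).add (integrable_const T⁻¹)) hpt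
  have hsplit : ∫ y, (T * ∑ p ∈ D, f p y
        + ∑ x ∈ S, wt B x y * Real.exp (κ * (inp x y - (B + κ)))
        + ∑ x ∈ S, wt B x y * Real.exp (κ * (inp x y - (B + κ))) + T⁻¹) ∂(_root_.stdGaussian N)
      = T * ∑ p ∈ D, Real.exp ((B ^ 2 / 2 + B * κ) * gg (inp p.1 p.2))
        + S.card * Real.exp (- κ ^ 2 / 2)
        + S.card * Real.exp (- κ ^ 2 / 2) + T⁻¹ := by
    refine (integral_add' ((hIf.add ht1.1).add ht1.1) (integrable_const T⁻¹)).trans ?_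
    rw [integral_add' (hIf.add ht1.1) ht1.1, integral_add' hIf ht1.1, ht1.2,
      integral_const_mul, integral_finsetSum _ fun p hp => (hf p hp).1,
      Finset.sum_congr rfl fun p hp => (hf p hp).2]
    simp
  have hmono2 := hmono.trans_eq hsplit
  unfold kmass
  calc _ ≤ (S.card : ℝ)⁻¹ * (T * ∑ p ∈ D, Real.exp ((B ^ 2 / 2 + B * κ) * gg (inp p.1 p.2))
        + S.card * Real.exp (- κ ^ 2 / 2)
        + S.card * Real.exp (- κ ^ 2 / 2) + T⁻¹) :=
        mul_le_mul_of_nonneg_left hmono2 (by positivity)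
    _ = _ := by field_simp; ring

/-! ## MMSE versus posterior mass -/

lemma integral_tot {N : ℕ} {S : Finset (V N)} (hS : onSphere S) (B : ℝ) :
    Integrable (fun y => tot S B y) (_root_.stdGaussian N) ∧
    ∫ y, tot S B y ∂(_root_.stdGaussian N) = S.card := by
  have h := tails_sum hS B 0 0 (by ring)
  simpa [tot] using h

lemma sum_prod_ww {N : ℕ} {S : Finset (V N)} (hne : S.Nonempty) (B : ℝ) (y : V N) :
    ∑ p ∈ S ×ˢ S, wt B p.1 y * wt B p.2 y / tot S B y = tot S B y := by
  rw [Finset.sum_product]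
  simp_rw [← Finset.sum_div, ← Finset.mul_sum, ← Finset.sum_mul]
  exact mul_div_cancel_right₀ _ (tot_pos hne B y).ne'

lemma mmse_eq' {N : ℕ} {S : Finset (V N)} (hS : onSphere S) (hne : S.Nonempty) (lam : ℝ) :
    mmse N S lam = (S.card : ℝ)⁻¹ * ∫ y, ∑ p ∈ S ×ˢ S,
      (1 - inp p.1 p.2) * (wt (√lam) p.1 y * wt (√lam) p.2 y / tot S (√lam) y)
        ∂(_root_.stdGaussian N) := by
  rw [mmse_eq hS hne]
  simp_rw [Finset.sum_product]

lemma mmse_nonneg {N : ℕ} (S : Finset (V N)) (lam : ℝ) : 0 ≤ mmse N S lam :=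
  Finset.sum_nonneg fun _ _ => integral_nonneg fun _ => sq_nonneg _

lemma integrable_main {N : ℕ} (S : Finset (V N)) (B : ℝ) (h : V N × V N → ℝ)
    {D : Finset (V N × V N)} (hD : D ⊆ S ×ˢ S) :
    Integrable (fun y => ∑ p ∈ D, h p * (wt B p.1 y * wt B p.2 y / tot S B y))
      (_root_.stdGaussian N) :=
  integrable_finsetSum _ fun p hp =>
    (integrable_ww B p.1 (Finset.mem_product.1 (hD hp)).2).const_mul _

lemma mmse_le_one {N : ℕ} {S : Finset (V N)} (hS : onSphere S) (hne : S.Nonempty) (lam : ℝ) :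
    mmse N S lam ≤ 1 := by
  have hM : (0 : ℝ) < S.card := by exact_mod_cast hne.card_pos
  have ht := integral_tot hS (√lam)
  have h : ∫ y, ∑ x ∈ S, ∑ x' ∈ S,
      (1 - inp x x') * (wt (√lam) x y * wt (√lam) x' y / tot S (√lam) y)
        ∂(_root_.stdGaussian N) ≤ S.card := by
    rw [← ht.2]
    refine integral_mono ?_ ht.1 fun y => ?_
    · have := integrable_main S (√lam) (fun p => 1 - inp p.1 p.2) (subset_refl (S ×ˢ S))
      simp_rw [Finset.sum_product] at this
      exact this
    · simp only
      rw [← variance_algebra hS hne]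
      have hA := tot_pos hne (√lam) y
      have key : ∀ i, ∑ x ∈ S, wt (√lam) x y * (x i - pm S (√lam) i y) ^ 2
          ≤ ∑ x ∈ S, wt (√lam) x y * (x i) ^ 2 := by
        intro i
        have e : ∀ x, wt (√lam) x y * (x i - pm S (√lam) i y) ^ 2 = wt (√lam) x y * (x i) ^ 2
            - 2 * pm S (√lam) i y * (wt (√lam) x y * x i)
            + (pm S (√lam) i y) ^ 2 * wt (√lam) x y := fun x => by ring
        simp_rw [e, Finset.sum_add_distrib, Finset.sum_sub_distrib, ← Finset.mul_sum]
        have h1 : ∑ x ∈ S, wt (√lam) x y = tot S (√lam) y := rfl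
        have h2 : ∑ x ∈ S, wt (√lam) x y * x i = pm S (√lam) i y * tot S (√lam) y := by
          unfold pm; field_simp
        rw [h1, h2]
        nlinarith [mul_nonneg (sq_nonneg (pm S (√lam) i y)) hA.le]
      rw [Finset.sum_comm]
      refine (Finset.sum_le_sum fun i _ => key i).trans_eq ?_
      rw [Finset.sum_comm]
      unfold tot
      refine Finset.sum_congr rfl fun x hx => ?_
      rw [← Finset.mul_sum, hS x hx, mul_one]
  rw [mmse_eq hS hne]
  calc _ ≤ (S.card : ℝ)⁻¹ * S.card := mul_le_mul_of_nonneg_left h (by positivity)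
    _ = 1 := inv_mul_cancel₀ hM.ne'

lemma mmse_upper {N : ℕ} {S : Finset (V N)} (hS : onSphere S) (hne : S.Nonempty) (lam ε : ℝ)
    (hε : 0 ≤ ε) :
    mmse N S lam ≤ ε + 2 * kmass S (√lam) ((S ×ˢ S).filter fun p => inp p.1 p.2 < 1 - ε) := by
  have hM : (0 : ℝ) < S.card := by exact_mod_cast hne.card_pos
  have ht := integral_tot hS (√lam)
  set B := √lam
  set D := (S ×ˢ S).filter fun p => inp p.1 p.2 < 1 - ε with hDdef
  have hD : D ⊆ S ×ˢ S := Finset.filter_subset _ _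
  have hID : Integrable (fun y => ∑ p ∈ D, wt B p.1 y * wt B p.2 y / tot S B y)
      (_root_.stdGaussian N) := by
    simpa using integrable_main S B (fun _ => 1) hD
  have h := integral_mono (μ := _root_.stdGaussian N)
    (integrable_main S B (fun p => 1 - inp p.1 p.2) (subset_refl (S ×ˢ S)))
    ((ht.1.const_mul ε).add (hID.const_mul 2)) (fun y => by
      simp only [Pi.add_apply]
      have hA := tot_pos hne B y
      rw [← sum_prod_ww hne B y, Finset.mul_sum, Finset.mul_sum, sum_prod_ww hne B y, hDdef,
        Finset.sum_filter, ← Finset.sum_add_distrib]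
      refine Finset.sum_le_sum fun p hp => ?_
      have hw1 := wt_pos B p.1 y
      have hw2 := wt_pos B p.2 y
      have hq : 0 < wt B p.1 y * wt B p.2 y / tot S B y := by positivity
      have hp' := Finset.mem_product.1 hp
      have hρ := abs_le.1 (abs_inp_le (inp_self_of_sphere hS hp'.1) (inp_self_of_sphere hS hp'.2))
      split_ifs with hc
      · nlinarith [mul_nonneg hε hq.le]
      · push Not at hc
        nlinarith)
  have hs : ∫ y, ((fun y => ε * tot S B y)
      + fun y => 2 * ∑ p ∈ D, wt B p.1 y * wt B p.2 y / tot S B y) y ∂(_root_.stdGaussian N)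
      = ε * S.card + 2 * ∫ y, ∑ p ∈ D, wt B p.1 y * wt B p.2 y / tot S B y
          ∂(_root_.stdGaussian N) := by
    rw [integral_add' (ht.1.const_mul ε) (hID.const_mul 2), integral_const_mul,
      integral_const_mul, ht.2]
  rw [mmse_eq' hS hne]
  unfold kmass
  calc _ ≤ (S.card : ℝ)⁻¹ * (ε * S.card + 2 * ∫ y, ∑ p ∈ D, wt B p.1 y * wt B p.2 y / tot S B y
          ∂(_root_.stdGaussian N)) :=
        mul_le_mul_of_nonneg_left (h.trans_eq hs) (by positivity)
    _ = _ := by field_simp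

lemma mmse_lower {N : ℕ} {S : Finset (V N)} (hS : onSphere S) (hne : S.Nonempty) (lam δ : ℝ)
    (hδ : 0 ≤ δ) :
    1 - δ - kmass S (√lam) ((S ×ˢ S).filter fun p => δ < inp p.1 p.2) ≤ mmse N S lam := by
  have hM : (0 : ℝ) < S.card := by exact_mod_cast hne.card_pos
  have ht := integral_tot hS (√lam)
  set B := √lam
  set D := (S ×ˢ S).filter fun p => δ < inp p.1 p.2 with hDdef
  have hD : D ⊆ S ×ˢ S := Finset.filter_subset _ _
  have hID : Integrable (fun y => ∑ p ∈ D, wt B p.1 y * wt B p.2 y / tot S B y)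
      (_root_.stdGaussian N) := by
    simpa using integrable_main S B (fun _ => 1) hD
  have h := integral_mono (μ := _root_.stdGaussian N)
    ((ht.1.const_mul (1 - δ)).sub hID)
    (integrable_main S B (fun p => 1 - inp p.1 p.2) (subset_refl (S ×ˢ S))) (fun y => by
      simp only [Pi.sub_apply]
      have hA := tot_pos hne B y
      rw [← sum_prod_ww hne B y, Finset.mul_sum, sum_prod_ww hne B y, hDdef,
        Finset.sum_filter, ← Finset.sum_sub_distrib]
      refine Finset.sum_le_sum fun p hp => ?_
      have hw1 := wt_pos B p.1 y
      have hw2 := wt_pos B p.2 y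
      have hq : 0 < wt B p.1 y * wt B p.2 y / tot S B y := by positivity
      have hp' := Finset.mem_product.1 hp
      have hρ := abs_le.1 (abs_inp_le (inp_self_of_sphere hS hp'.1) (inp_self_of_sphere hS hp'.2))
      split_ifs with hc
      · nlinarith [mul_nonneg hδ hq.le]
      · push Not at hc
        nlinarith)
  have hs : ∫ y, ((fun y => (1 - δ) * tot S B y)
      - fun y => ∑ p ∈ D, wt B p.1 y * wt B p.2 y / tot S B y) y ∂(_root_.stdGaussian N)
      = (1 - δ) * S.card - ∫ y, ∑ p ∈ D, wt B p.1 y * wt B p.2 y / tot S B y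
          ∂(_root_.stdGaussian N) := by
    rw [integral_sub' (ht.1.const_mul _) hID, integral_const_mul, ht.2]
  rw [mmse_eq' hS hne]
  unfold kmass
  calc _ = (S.card : ℝ)⁻¹ * ((1 - δ) * S.card
          - ∫ y, ∑ p ∈ D, wt B p.1 y * wt B p.2 y / tot S B y ∂(_root_.stdGaussian N)) := by
        field_simp
    _ ≤ _ := mul_le_mul_of_nonneg_left (hs.symm.trans_le h) (by positivity)

/-! ## The overlap hypothesis -/

lemma prod_unif_apply {N : ℕ} {S : Finset (V N)} (hne : S.Nonempty) (t : ℝ) :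
    ((unifOn S).prod (unifOn S)) {q | t ≤ inp q.1 q.2}
      = ENNReal.ofReal (((S.card : ℝ) ^ 2)⁻¹ *
          (((S ×ˢ S).filter fun p => t ≤ inp p.1 p.2).card : ℝ)) := by
  have hM : (0 : ℝ) < S.card := by exact_mod_cast hne.card_pos
  have hmeas : MeasurableSet {q : V N × V N | t ≤ inp q.1 q.2} := by
    refine measurableSet_le measurable_const ?_
    unfold inp; fun_prop
  rw [Measure.prod_apply hmeas, unifOn_lintegral _ _ (measurable_measure_prodMk_left hmeas)]
  have h : ∀ x, unifOn S (Prod.mk x ⁻¹' {q : V N × V N | t ≤ inp q.1 q.2})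
      = (S.card : ℝ≥0∞)⁻¹ * ∑ x' ∈ S, if t ≤ inp x x' then 1 else 0 := by
    intro x
    have hm : MeasurableSet (Prod.mk x ⁻¹' {q : V N × V N | t ≤ inp q.1 q.2}) :=
      measurable_prodMk_left hmeas
    rw [← lintegral_indicator_one hm, unifOn_lintegral _ _ (measurable_one.indicator hm)]
    congr 1
  simp_rw [h, ← Finset.mul_sum]
  have h2 : ∑ x ∈ S, ∑ x' ∈ S, (if t ≤ inp x x' then (1 : ℝ≥0∞) else 0)
      = (((S ×ˢ S).filter fun p => t ≤ inp p.1 p.2).card : ℝ≥0∞) := by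
    rw [Finset.card_filter, Finset.sum_product]
    push_cast
    rfl
  rw [h2, ENNReal.ofReal_mul (by positivity), ENNReal.ofReal_inv_of_pos (by positivity),
    ENNReal.ofReal_pow hM.le, ENNReal.ofReal_natCast, ENNReal.ofReal_natCast, ← mul_assoc, sq,
    ENNReal.mul_inv (by simp) (by simp)]

/-- Average of `M ^ gg(r)` over pairs. -/
def RR {N : ℕ} (S : Finset (V N)) : ℝ :=
  ((S.card : ℝ) ^ 2)⁻¹ * ∑ p ∈ S ×ˢ S, Real.exp (Real.log S.card * gg (max (inp p.1 p.2) 0))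

lemma gg_le {t r : ℝ} (ht : 0 ≤ t) (htr : t ≤ r) : gg r ≤ gg t + 2 * (r - t) := by
  unfold gg
  have h1 : 0 < 1 + t := by linarith
  have h2 : 0 < 1 + r := by linarith
  have : 2 * r / (1 + r) - 2 * t / (1 + t) = 2 * (r - t) / ((1 + r) * (1 + t)) := by
    field_simp; ring
  have h3 : 2 * (r - t) / ((1 + r) * (1 + t)) ≤ 2 * (r - t) := by
    apply div_le_self (by linarith)
    nlinarith
  linarith

lemma gg_mono {t r : ℝ} (ht : 0 ≤ t) (htr : t ≤ r) : gg t ≤ gg r := by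
  unfold gg
  rw [div_le_div_iff₀ (by linarith) (by linarith)]
  nlinarith

lemma overlap_real {S : ∀ N : ℕ, Finset (V N)}
    (hM : Tendsto (fun N => (S N).card) atTop atTop) {t : ℝ}
    (h : overlapRateLe S t (-(2 * t / (1 + t)))) {η : ℝ} (hη : 0 < η) :
    ∀ᶠ N in atTop, (((S N).card : ℝ) ^ 2)⁻¹ *
        (((S N ×ˢ S N).filter fun p => t ≤ inp p.1 p.2).card : ℝ)
      ≤ Real.exp (Real.log (S N).card * (-gg t + η)) := by
  filter_upwards [h η hη, hM.eventually_ge_atTop 1] with N hN hN1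
  have hne : (S N).Nonempty := Finset.card_pos.1 hN1
  have hpos : (0 : ℝ) < (S N).card := by exact_mod_cast hN1
  rw [prod_unif_apply hne, ← ENNReal.ofReal_natCast, ENNReal.ofReal_rpow_of_pos hpos] at hN
  have := (ENNReal.ofReal_le_ofReal_iff (by positivity)).1 hN
  rwa [Real.rpow_def_of_pos hpos] at this

lemma RR_bound {S : ∀ N : ℕ, Finset (V N)} (hsphere : ∀ N, onSphere (S N))
    (hM : Tendsto (fun N => (S N).card) atTop atTop)
    (hoverlap : ∀ t : ℝ, 0 ≤ t → t ≤ 1 → overlapRateLe S t (-(2 * t / (1 + t))))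
    {η : ℝ} (hη : 0 < η) :
    ∀ᶠ N in atTop, RR (S N) ≤ Real.exp (Real.log (S N).card * η) := by
  obtain ⟨K, hK⟩ := exists_nat_gt (8 / η)
  have hK0 : (0 : ℝ) < K := lt_trans (by positivity) hK
  have hK2 : 2 / (K : ℝ) ≤ η / 4 := by
    rw [div_lt_iff₀ hη] at hK
    rw [div_le_iff₀ hK0]; nlinarith
  have hlog : Tendsto (fun N => Real.log (S N).card) atTop atTop :=
    Real.tendsto_log_atTop.comp (tendsto_natCast_atTop_atTop.comp hM)
  have hall : ∀ᶠ N in atTop, ∀ k ∈ Finset.range (K + 1),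
      (((S N).card : ℝ) ^ 2)⁻¹ *
        (((S N ×ˢ S N).filter fun p => (k : ℝ) / K ≤ inp p.1 p.2).card : ℝ)
      ≤ Real.exp (Real.log (S N).card * (-gg ((k : ℝ) / K) + η / 4)) := by
    rw [Filter.eventually_all_finset]
    intro k hk
    have hk' : (k : ℝ) ≤ K := by exact_mod_cast Nat.lt_succ_iff.1 (Finset.mem_range.1 hk)
    exact overlap_real hM (hoverlap _ (by positivity) ((div_le_one hK0).2 hk')) (by positivity)
  have hbig := hlog.eventually_ge_atTop (Real.log (K + 1) / (η / 2))
  filter_upwards [hall, hbig, hM.eventually_ge_atTop 1] with N hN hNbig hN1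
  have hne : (S N).Nonempty := Finset.card_pos.1 hN1
  have hpos : (0 : ℝ) < (S N).card := by exact_mod_cast hN1
  set L := Real.log (S N).card with hL
  have hL0 : 0 ≤ L := Real.log_natCast_nonneg _
  -- pointwise bin bound
  have hpt : ∀ p ∈ S N ×ˢ S N, Real.exp (L * gg (max (inp p.1 p.2) 0))
      ≤ ∑ k ∈ Finset.range (K + 1), if (k : ℝ) / K ≤ max (inp p.1 p.2) 0 then
          Real.exp (L * (gg ((k : ℝ) / K) + η / 4)) else 0 := by
    intro p hp
    have hp' := Finset.mem_product.1 hp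
    have hρ := abs_le.1 (abs_inp_le (inp_self_of_sphere (hsphere N) hp'.1)
      (inp_self_of_sphere (hsphere N) hp'.2))
    set r := max (inp p.1 p.2) 0
    have hr0 : 0 ≤ r := le_max_right _ _
    have hr1 : r ≤ 1 := max_le hρ.2 zero_le_one
    set k := ⌊r * K⌋₊ with hk
    have hk1 : (k : ℝ) ≤ r * K := Nat.floor_le (by positivity)
    have hk2 : r * K < k + 1 := Nat.lt_floor_add_one _
    have hkK : k ∈ Finset.range (K + 1) := by
      rw [Finset.mem_range, Nat.lt_succ_iff]
      have : (k : ℝ) ≤ K := hk1.trans (by nlinarith)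
      exact_mod_cast this
    have hkr : (k : ℝ) / K ≤ r := (div_le_iff₀ hK0).2 hk1
    have hrk : r - (k : ℝ) / K ≤ 1 / K := by
      rw [sub_le_iff_le_add, ← add_div, le_div_iff₀ hK0]; linarith
    have hg := gg_le (by positivity) hkr
    refine le_trans ?_ (Finset.single_le_sum (f := fun k : ℕ => if (k : ℝ) / K ≤ r then
          Real.exp (L * (gg ((k : ℝ) / K) + η / 4)) else 0)
          (fun j _ => by split_ifs <;> positivity) hkK)
    simp only [if_pos hkr]
    refine Real.exp_le_exp.2 (mul_le_mul_of_nonneg_left ?_ hL0)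
    have : 2 * (1 / (K : ℝ)) = 2 / K := by ring
    linarith
  have hbin : ∀ k ∈ Finset.range (K + 1), (((S N).card : ℝ) ^ 2)⁻¹ * ∑ p ∈ S N ×ˢ S N,
      (if (k : ℝ) / K ≤ max (inp p.1 p.2) 0 then
          Real.exp (L * (gg ((k : ℝ) / K) + η / 4)) else 0) ≤ Real.exp (L * (η / 2)) := by
    intro k hk
    rw [← Finset.sum_filter, Finset.sum_const, nsmul_eq_mul, ← mul_assoc]
    have hc : (((S N).card : ℝ) ^ 2)⁻¹ *
        (((S N ×ˢ S N).filter fun p => (k : ℝ) / K ≤ max (inp p.1 p.2) 0).card : ℝ)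
        ≤ Real.exp (L * (-gg ((k : ℝ) / K) + η / 4)) := by
      rcases Nat.eq_zero_or_pos k with h0 | h0
      · subst h0
        have h1 : (((S N ×ˢ S N).filter fun p =>
            ((0 : ℕ) : ℝ) / K ≤ max (inp p.1 p.2) 0).card : ℝ) ≤ ((S N).card : ℝ) ^ 2 := by
          have := Finset.card_filter_le (S N ×ˢ S N)
            (fun p => ((0 : ℕ) : ℝ) / K ≤ max (inp p.1 p.2) 0)
          rw [Finset.card_product, ← sq] at this
          exact_mod_cast this
        have h2 : (1 : ℝ) ≤ Real.exp (L * (-gg (((0 : ℕ) : ℝ) / K) + η / 4)) := by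
          apply Real.one_le_exp
          simp only [gg, Nat.cast_zero, zero_div, mul_zero, neg_zero, zero_add]
          positivity
        refine le_trans ?_ h2
        rw [inv_mul_le_iff₀ (by positivity), mul_one]
        exact h1
      · have hkpos : (0 : ℝ) < (k : ℝ) / K := by positivity
        have e : ((S N ×ˢ S N).filter fun p => (k : ℝ) / K ≤ max (inp p.1 p.2) 0)
            = (S N ×ˢ S N).filter fun p => (k : ℝ) / K ≤ inp p.1 p.2 := by
          refine Finset.filter_congr fun p _ => ?_
          rw [le_max_iff]
          exact ⟨fun h => h.resolve_right (not_le.2 hkpos), Or.inl⟩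
        rw [e]
        exact hN k hk
    refine (mul_le_mul_of_nonneg_right hc (Real.exp_pos _).le).trans_eq ?_
    rw [← Real.exp_add]; congr 1; ring
  have hfin : RR (S N) ≤ (K + 1) * Real.exp (L * (η / 2)) := by
    unfold RR
    refine (mul_le_mul_of_nonneg_left (Finset.sum_le_sum hpt) (by positivity)).trans ?_
    rw [Finset.sum_comm, Finset.mul_sum]
    refine (Finset.sum_le_sum hbin).trans_eq ?_
    simp
  refine hfin.trans ?_
  rw [div_le_iff₀ (by positivity)] at hNbig
  have hK1 : (K : ℝ) + 1 ≤ Real.exp (L * (η / 2)) := by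
    rw [← Real.log_le_iff_le_exp (by positivity)]; exact hNbig
  calc _ ≤ Real.exp (L * (η / 2)) * Real.exp (L * (η / 2)) :=
        mul_le_mul_of_nonneg_right hK1 (Real.exp_pos _).le
    _ = _ := by rw [← Real.exp_add]; congr 1; ring

/-! ## Asymptotics -/

lemma tendsto_exp_neg {S : ∀ N : ℕ, Finset (V N)}
    (hM : Tendsto (fun N => (S N).card) atTop atTop) {c : ℝ} (hc : 0 < c) :
    Tendsto (fun N => Real.exp (-(Real.log (S N).card * c))) atTop (nhds 0) := by
  have hlog : Tendsto (fun N => Real.log (S N).card) atTop atTop :=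
    Real.tendsto_log_atTop.comp (tendsto_natCast_atTop_atTop.comp hM)
  exact Real.tendsto_exp_neg_atTop_nhds_zero.comp (hlog.atTop_mul_const hc)

lemma part_above {S : ∀ N : ℕ, Finset (V N)} (hsphere : ∀ N, onSphere (S N))
    (hM : Tendsto (fun N => (S N).card) atTop atTop)
    (hoverlap : ∀ t : ℝ, 0 ≤ t → t ≤ 1 → overlapRateLe S t (-(2 * t / (1 + t))))
    {β : ℝ} (hβ : 1 < β) :
    Tendsto (fun N => mmse N (S N) (β * (2 * Real.log (S N).card))) atTop (nhds 0) := by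
  rw [Metric.tendsto_nhds]
  intro e he
  set ε := min (e / 2) 1 with hε
  have hε0 : 0 < ε := lt_min (by positivity) one_pos
  have hε1 : ε ≤ 1 := min_le_right _ _
  have hεe : ε ≤ e / 2 := min_le_left _ _
  set b := √β with hb
  have hb2 : b ^ 2 = β := Real.sq_sqrt (by linarith)
  have hb0 : 0 < b := Real.sqrt_pos.2 (by linarith)
  set η := (β - 1) * ε / 8 with hη
  have hη0 : 0 < η := by have : 0 < β - 1 := by linarith
                         positivity
  set d := η / (2 * b) with hd
  have hd0 : 0 < d := by positivity
  have hbd : 2 * b * d = η := by rw [hd]; field_simp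
  have hsmall : ∀ᶠ N in atTop, Real.exp (-(Real.log (S N).card * (2 * η)))
      + 2 * Real.exp (-(Real.log (S N).card * d ^ 2)) < e / 4 := by
    have h1 := (tendsto_exp_neg hM (c := 2 * η) (by positivity)).add
      ((tendsto_exp_neg hM (c := d ^ 2) (by positivity)).const_mul 2)
    simp only [mul_zero, add_zero] at h1
    exact h1.eventually_lt_const (by positivity)
  filter_upwards [hsmall, RR_bound hsphere hM hoverlap hη0, hM.eventually_ge_atTop 1]
    with N hN hR hN1
  have hne : (S N).Nonempty := Finset.card_pos.1 hN1
  have hpos : (0 : ℝ) < (S N).card := by exact_mod_cast hN1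
  have hup := mmse_upper (hsphere N) hne (β * (2 * Real.log (S N).card)) ε hε0.le
  set L := Real.log (S N).card with hL
  have hL0 : 0 ≤ L := Real.log_natCast_nonneg _
  have hMexp : ((S N).card : ℝ) = Real.exp L := (Real.exp_log hpos).symm
  set B := √(β * (2 * L)) with hB
  have hB0 : 0 ≤ B := Real.sqrt_nonneg _
  have hB2 : B ^ 2 = β * (2 * L) := Real.sq_sqrt (by positivity)
  set κ := d * √(2 * L) with hκ
  have hκ0 : 0 ≤ κ := by positivity
  have hκ2 : κ ^ 2 = d ^ 2 * (2 * L) := by rw [hκ, mul_pow, Real.sq_sqrt (by positivity)]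
  have hBκ : B * κ = L * η := by
    rw [hB, Real.sqrt_mul (by linarith), hκ]
    have : √(2 * L) * √(2 * L) = 2 * L := Real.mul_self_sqrt (by positivity)
    calc √β * √(2 * L) * (d * √(2 * L)) = b * d * (√(2 * L) * √(2 * L)) := by rw [hb]; ring
      _ = L * η := by rw [this, ← hbd]; ring
  set D := (S N ×ˢ S N).filter fun p => inp p.1 p.2 < 1 - ε with hDdef
  have hD : D ⊆ S N ×ˢ S N := Finset.filter_subset _ _
  have hk := kmass_bound1 (hsphere N) hne B κ hB0 hκ0 hD
  have hterm : ∀ p ∈ D, Real.exp (-(B ^ 2 / 2) * (1 - gg (max (inp p.1 p.2) 0)) + B * κ)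
      ≤ Real.exp (-(L * 1)) * Real.exp (-(L * (3 * η))) * Real.exp (L * gg (max (inp p.1 p.2) 0)) := by
    intro p hp
    rw [← Real.exp_add, ← Real.exp_add, hB2, hBκ]
    refine Real.exp_le_exp.2 ?_
    have hp2 := (Finset.mem_filter.1 hp).2
    set r := max (inp p.1 p.2) 0
    have hr0 : 0 ≤ r := le_max_right _ _
    have hr1 : r ≤ 1 - ε := max_le hp2.le (by linarith)
    have hg : ε / 2 ≤ 1 - gg r := by
      have : 1 - gg r = (1 - r) / (1 + r) := by
        unfold gg; field_simp; ring
      rw [this, le_div_iff₀ (by linarith)]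
      nlinarith
    have h4 : 4 * η ≤ (β - 1) * (1 - gg r) := by
      have := mul_le_mul_of_nonneg_left hg (show 0 ≤ β - 1 by linarith)
      rw [hη]; linarith
    nlinarith [mul_le_mul_of_nonneg_left h4 hL0]
  have hsum : ((S N).card : ℝ)⁻¹ * ∑ p ∈ D,
        Real.exp (-(B ^ 2 / 2) * (1 - gg (max (inp p.1 p.2) 0)) + B * κ)
      ≤ Real.exp (-(L * (2 * η))) := by
    have h1 : ∑ p ∈ D, Real.exp (-(B ^ 2 / 2) * (1 - gg (max (inp p.1 p.2) 0)) + B * κ)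
        ≤ Real.exp (-(L * 1)) * Real.exp (-(L * (3 * η))) *
          ∑ p ∈ S N ×ˢ S N, Real.exp (L * gg (max (inp p.1 p.2) 0)) := by
      refine (Finset.sum_le_sum hterm).trans ?_
      rw [← Finset.mul_sum]
      exact mul_le_mul_of_nonneg_left
        (Finset.sum_le_sum_of_subset_of_nonneg hD fun _ _ _ => (Real.exp_pos _).le) (by positivity)
    calc _ ≤ ((S N).card : ℝ)⁻¹ * (Real.exp (-(L * 1)) * Real.exp (-(L * (3 * η))) *
          ∑ p ∈ S N ×ˢ S N, Real.exp (L * gg (max (inp p.1 p.2) 0))) :=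
          mul_le_mul_of_nonneg_left h1 (by clear hMexp; positivity)
      _ = Real.exp (-(L * (3 * η))) * RR (S N) := by
          unfold RR
          rw [mul_one, Real.exp_neg L, ← hMexp, ← hL]
          clear hMexp; field_simp
      _ ≤ Real.exp (-(L * (3 * η))) * Real.exp (L * η) :=
          mul_le_mul_of_nonneg_left hR (Real.exp_pos _).le
      _ = _ := by rw [← Real.exp_add]; congr 1; ring
  have hκe : Real.exp (-κ ^ 2 / 2) = Real.exp (-(L * d ^ 2)) := by
    congr 1; rw [neg_div, hκ2]; ring
  rw [hκe] at hk
  rw [Real.dist_eq, sub_zero, abs_of_nonneg (mmse_nonneg _ _)]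
  linarith

lemma part_below {S : ∀ N : ℕ, Finset (V N)} (hsphere : ∀ N, onSphere (S N))
    (hM : Tendsto (fun N => (S N).card) atTop atTop)
    (hoverlap : ∀ t : ℝ, 0 ≤ t → t ≤ 1 → overlapRateLe S t (-(2 * t / (1 + t))))
    {β : ℝ} (hβ0 : 0 ≤ β) (hβ : β < 1) :
    Tendsto (fun N => mmse N (S N) (β * (2 * Real.log (S N).card))) atTop (nhds 1) := by
  rw [Metric.tendsto_nhds]
  intro e he
  set δ := e / 2 with hδ
  have hδ0 : 0 < δ := by positivity
  set b := √β with hb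
  have hb0 : 0 ≤ b := Real.sqrt_nonneg _
  have hb1 : b ≤ 1 := Real.sqrt_le_one.2 hβ.le
  have hgδ : 0 < gg δ := by unfold gg; positivity
  set η := (1 - β) * gg δ / 8 with hη
  have hη0 : 0 < η := by have : 0 < 1 - β := by linarith
                         positivity
  have hsmall : ∀ᶠ N in atTop, Real.exp (-(Real.log (S N).card * (4 * η)))
      + 2 * Real.exp (-(Real.log (S N).card * η ^ 2))
      + Real.exp (-(Real.log (S N).card * η)) < e / 2 := by
    have h1 := ((tendsto_exp_neg hM (c := 4 * η) (by positivity)).add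
      ((tendsto_exp_neg hM (c := η ^ 2) (by positivity)).const_mul 2)).add
      (tendsto_exp_neg hM hη0)
    simp only [mul_zero, add_zero] at h1
    exact h1.eventually_lt_const (by positivity)
  filter_upwards [hsmall, RR_bound hsphere hM hoverlap hη0, hM.eventually_ge_atTop 1]
    with N hN hR hN1
  have hne : (S N).Nonempty := Finset.card_pos.1 hN1
  have hpos : (0 : ℝ) < (S N).card := by exact_mod_cast hN1
  have hlow := mmse_lower (hsphere N) hne (β * (2 * Real.log (S N).card)) δ hδ0.le
  have hle1 := mmse_le_one (hsphere N) hne (β * (2 * Real.log (S N).card))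
  set L := Real.log (S N).card with hL
  have hL0 : 0 ≤ L := Real.log_natCast_nonneg _
  have hMexp : ((S N).card : ℝ) = Real.exp L := (Real.exp_log hpos).symm
  set B := √(β * (2 * L)) with hB
  have hB0 : 0 ≤ B := Real.sqrt_nonneg _
  have hB2 : B ^ 2 = β * (2 * L) := Real.sq_sqrt (by positivity)
  set κ := η * √(2 * L) with hκ
  have hκ0 : 0 ≤ κ := by positivity
  have hκ2 : κ ^ 2 = η ^ 2 * (2 * L) := by rw [hκ, mul_pow, Real.sq_sqrt (by positivity)]
  have hBκ : B * κ ≤ L * (2 * η) := by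
    rw [hB, Real.sqrt_mul hβ0, hκ]
    have : √(2 * L) * √(2 * L) = 2 * L := Real.mul_self_sqrt (by positivity)
    calc √β * √(2 * L) * (η * √(2 * L)) = b * (η * (√(2 * L) * √(2 * L))) := by rw [hb]; ring
      _ ≤ 1 * (η * (√(2 * L) * √(2 * L))) := mul_le_mul_of_nonneg_right hb1 (by positivity)
      _ = L * (2 * η) := by rw [this]; ring
  set D := (S N ×ˢ S N).filter fun p => δ < inp p.1 p.2 with hDdef
  have hD : D ⊆ S N ×ˢ S N := Finset.filter_subset _ _
  have hk := kmass_bound2 (hsphere N) hne B κ (Real.exp (L * (η - 1))) hB0 hκ0 (Real.exp_pos _) hD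
    (fun p hp => hδ0.le.trans (Finset.mem_filter.1 hp).2.le)
  have hterm : ∀ p ∈ D, Real.exp ((B ^ 2 / 2 + B * κ) * gg (inp p.1 p.2))
      ≤ Real.exp (-(L * (6 * η))) * Real.exp (L * gg (max (inp p.1 p.2) 0)) := by
    intro p hp
    rw [← Real.exp_add, hB2]
    refine Real.exp_le_exp.2 ?_
    obtain ⟨hp1, hp2⟩ := Finset.mem_filter.1 hp
    have hp' := Finset.mem_product.1 hp1
    rw [max_eq_left (hδ0.le.trans hp2.le)]
    have hρ := abs_le.1 (abs_inp_le (inp_self_of_sphere (hsphere N) hp'.1)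
      (inp_self_of_sphere (hsphere N) hp'.2))
    set r := inp p.1 p.2
    have hr0 : 0 < r := hδ0.trans hp2
    have hg1 : gg r ≤ 1 := by
      unfold gg; rw [div_le_one (by linarith)]; linarith [hρ.2]
    have hg2 : gg δ ≤ gg r := gg_mono hδ0.le hp2.le
    have hg0 : 0 ≤ gg r := hgδ.le.trans hg2
    have h1 : B * κ * gg r ≤ L * (2 * η) :=
      (mul_le_of_le_one_right (by positivity) hg1).trans hBκ
    have h2 : 8 * η ≤ (1 - β) * gg r := by
      have := mul_le_mul_of_nonneg_left hg2 (show 0 ≤ 1 - β by linarith)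
      rw [hη]; linarith
    nlinarith [mul_le_mul_of_nonneg_left h2 hL0]
  have hsum : ((S N).card : ℝ)⁻¹ * Real.exp (L * (η - 1)) * ∑ p ∈ D,
        Real.exp ((B ^ 2 / 2 + B * κ) * gg (inp p.1 p.2))
      ≤ Real.exp (-(L * (4 * η))) := by
    have h1 : ∑ p ∈ D, Real.exp ((B ^ 2 / 2 + B * κ) * gg (inp p.1 p.2))
        ≤ Real.exp (-(L * (6 * η))) *
          ∑ p ∈ S N ×ˢ S N, Real.exp (L * gg (max (inp p.1 p.2) 0)) := by
      refine (Finset.sum_le_sum hterm).trans ?_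
      rw [← Finset.mul_sum]
      exact mul_le_mul_of_nonneg_left
        (Finset.sum_le_sum_of_subset_of_nonneg hD fun _ _ _ => (Real.exp_pos _).le) (by positivity)
    have hT : Real.exp (L * (η - 1)) = Real.exp (L * η) * ((S N).card : ℝ)⁻¹ := by
      rw [hMexp, ← Real.exp_neg, ← Real.exp_add]; congr 1; ring
    calc _ ≤ ((S N).card : ℝ)⁻¹ * Real.exp (L * (η - 1)) * (Real.exp (-(L * (6 * η))) *
          ∑ p ∈ S N ×ˢ S N, Real.exp (L * gg (max (inp p.1 p.2) 0))) :=
          mul_le_mul_of_nonneg_left h1 (by clear hMexp; positivity)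
      _ = Real.exp (L * η) * Real.exp (-(L * (6 * η))) * RR (S N) := by
          unfold RR
          rw [hT, ← hL]
          clear hMexp; field_simp
      _ ≤ Real.exp (L * η) * Real.exp (-(L * (6 * η))) * Real.exp (L * η) :=
          mul_le_mul_of_nonneg_left hR (by positivity)
      _ = _ := by rw [← Real.exp_add, ← Real.exp_add]; congr 1; ring
  have hlast : ((S N).card : ℝ)⁻¹ * (Real.exp (L * (η - 1)))⁻¹ = Real.exp (-(L * η)) := by
    rw [hMexp, ← Real.exp_neg, ← Real.exp_neg, ← Real.exp_add]; congr 1; ring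
  have hκe : Real.exp (-κ ^ 2 / 2) = Real.exp (-(L * η ^ 2)) := by
    congr 1; rw [neg_div, hκ2]; ring
  rw [hκe, hlast] at hk
  rw [Real.dist_eq, abs_lt]
  constructor <;> linarith

/-- Theorem 2 of the paper. If for every `t ∈ [0,1]` the overlap of two
independent draws from the prior satisfies
`limsup_N (1/log M_N) log P_N^{⊗2}[⟨X,X'⟩ ≥ t] ≤ -2t/(1+t)`, then the all-or-nothing
phenomenon holds with critical SNR `λ_N = 2 log M_N`. -/
theorem statement3 (S : ∀ N : ℕ, Finset (V N)) (hsphere : ∀ N, onSphere (S N))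
    (hM : Tendsto (fun N => (S N).card) atTop atTop)
    (hoverlap : ∀ t : ℝ, 0 ≤ t → t ≤ 1 → overlapRateLe S t (-(2 * t / (1 + t)))) :
    allOrNothing S (fun N => 2 * Real.log (S N).card) := by
  exact ⟨fun β h0 h1 => part_below hsphere hM hoverlap h0 h1,
    fun β h1 => part_above hsphere hM hoverlap h1⟩
end
end

section
/- There exists a constant C > 0 such that for all λ ≥ 1 and all ρ ∈ [−1, 1] the following holds. Let G₁, G₂ be independent standard Gaussian random variables and set W = G₁/√λ and W' = (ρ·G₁ + √(1−ρ²)·G₂)/√λ, so that (W, W') is centered bivariate Gaussian with Var(W) = Var(W') = 1/λ and Cov(W, W') = ρ/λ. Then E[exp(λ(W + W' − 1)) · 1{|W − 1| ≤ λ^{−1/4}} · 1{|W' − 1| ≤ λ^{−1/4}}] ≤ exp(λ·(max(ρ/(1+ρ), 0) + C·λ^{−1/4})), where for ρ = −1 the quantity max(ρ/(1+ρ), 0) is interpreted as 0. -/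
open MeasureTheory ProbabilityTheory

lemma aux_int (a b : ℝ) :
    Integrable (fun g : ℝ × ℝ => Real.exp (a * g.1) * Real.exp (b * g.2))
      ((gaussianReal 0 1).prod (gaussianReal 0 1)) :=
  (integrable_exp_mul_gaussianReal a).mul_prod (integrable_exp_mul_gaussianReal b)

lemma aux_val (a b : ℝ) :
    ∫ g : ℝ × ℝ, Real.exp (a * g.1) * Real.exp (b * g.2)
      ∂((gaussianReal 0 1).prod (gaussianReal 0 1)) = Real.exp ((a ^ 2 + b ^ 2) / 2) := by
  have h : ∀ c : ℝ, ∫ x, Real.exp (c * x) ∂(gaussianReal 0 1) = Real.exp (c ^ 2 / 2) := by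
    intro c
    have := congrFun (mgf_id_gaussianReal (μ := 0) (v := 1)) c
    simpa [mgf] using this
  rw [integral_prod_mul (fun x => Real.exp (a * x)) (fun x => Real.exp (b * x)), h, h,
    ← Real.exp_add]
  ring_nf

/-- Proposition 6 of the paper. There is a constant `C > 0` such that for
all `λ ≥ 1` and `ρ ∈ [-1,1]`, with `W = G₁/√λ` and `W' = (ρ G₁ + √(1-ρ²) G₂)/√λ` for
independent standard Gaussians `G₁, G₂`,
`E[exp(λ(W + W' - 1)) 1{|W-1| ≤ λ^{-1/4}} 1{|W'-1| ≤ λ^{-1/4}}]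
  ≤ exp(λ ((ρ/(1+ρ))₊ + C λ^{-1/4}))`
(with the convention `(ρ/(1+ρ))₊ = 0` for `ρ = -1`, which agrees with Lean's `(-1)/0 = 0`). -/
theorem statement10 :
    ∃ C : ℝ, 0 < C ∧ ∀ lam : ℝ, 1 ≤ lam → ∀ ρ : ℝ, -1 ≤ ρ → ρ ≤ 1 →
      ∫ g in {g : ℝ × ℝ |
          |g.1 / Real.sqrt lam - 1| ≤ lam ^ (-(1 / 4) : ℝ) ∧
          |(ρ * g.1 + Real.sqrt (1 - ρ ^ 2) * g.2) / Real.sqrt lam - 1|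
            ≤ lam ^ (-(1 / 4) : ℝ)},
        Real.exp (lam * (g.1 / Real.sqrt lam
            + (ρ * g.1 + Real.sqrt (1 - ρ ^ 2) * g.2) / Real.sqrt lam - 1))
        ∂((gaussianReal 0 1).prod (gaussianReal 0 1))
      ≤ Real.exp (lam * (max (ρ / (1 + ρ)) 0 + C * lam ^ (-(1 / 4) : ℝ))) := by
  refine ⟨1, one_pos, ?_⟩
  intro lam hlam ρ h1 h2
  obtain ⟨t, ht1, ht2, htM⟩ : ∃ t : ℝ, 1 / 2 ≤ t ∧ t ≤ 1 ∧
      t ^ 2 * (1 + ρ) - 2 * t + 1 ≤ max (ρ / (1 + ρ)) 0 := by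
    rcases le_total 0 ρ with h | h
    · have hp : 0 < 1 + ρ := by linarith
      refine ⟨1 / (1 + ρ), ?_, ?_, le_trans (le_of_eq ?_) (le_max_left _ _)⟩
      · exact one_div_le_one_div_of_le hp (by linarith)
      · rw [div_le_one hp]; linarith
      · field_simp; ring
    · exact ⟨1, by norm_num, le_rfl, le_trans (by linarith) (le_max_right _ _)⟩
  set M := max (ρ / (1 + ρ)) 0
  set ε := lam ^ (-(1 / 4) : ℝ)
  set r := Real.sqrt (1 - ρ ^ 2) with hr
  set s := Real.sqrt lam with hs
  have hε : 0 ≤ ε := Real.rpow_nonneg (by linarith) _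
  have hr2 : r ^ 2 = 1 - ρ ^ 2 := Real.sq_sqrt (by nlinarith)
  have hs2 : s ^ 2 = lam := Real.sq_sqrt (by linarith)
  have hs0 : 0 < s := Real.sqrt_pos.mpr (by linarith)
  set K := lam * ((1 - t) * 2 + 2 * ε * (1 - t) - 1) with hK
  set a := t * s * (1 + ρ) with ha
  set b := t * s * r with hb
  have hint := (aux_int a b).const_mul (Real.exp K)
  have hmeas : MeasurableSet {g : ℝ × ℝ | |g.1 / s - 1| ≤ ε ∧
      |(ρ * g.1 + r * g.2) / s - 1| ≤ ε} := by
    apply MeasurableSet.inter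
    · exact (isClosed_le (f := fun g : ℝ × ℝ => |g.1 / s - 1|) (g := fun _ => ε)
        (by fun_prop) (by fun_prop)).measurableSet
    · exact (isClosed_le (f := fun g : ℝ × ℝ => |(ρ * g.1 + r * g.2) / s - 1|) (g := fun _ => ε)
        (by fun_prop) (by fun_prop)).measurableSet
  refine le_trans (integral_mono_of_nonneg
    (g := fun g : ℝ × ℝ => Real.exp K * (Real.exp (a * g.1) * Real.exp (b * g.2)))
    (ae_of_all _ fun _ => (Real.exp_pos _).le) hint.integrableOn
    (ae_restrict_of_forall_mem hmeas ?_)) ?_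
  · rintro g ⟨hg1, hg2⟩
    simp only
    rw [← Real.exp_add, ← Real.exp_add]
    apply Real.exp_le_exp.mpr
    set x := g.1 / s with hx
    set y := (ρ * g.1 + r * g.2) / s with hy
    have e : a * g.1 + b * g.2 = lam * (t * (x + y)) := by
      rw [ha, hb, hx, hy, ← hs2]; field_simp; ring
    rw [e, hK, ← mul_add]
    apply mul_le_mul_of_nonneg_left _ (by linarith)
    have q1 := (abs_le.mp hg1).2
    have q2 := (abs_le.mp hg2).2
    nlinarith [mul_le_mul_of_nonneg_left (add_le_add q1 q2) (sub_nonneg.mpr ht2)]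
  · refine le_trans (setIntegral_le_integral hint (ae_of_all _ fun _ => by positivity)) ?_
    rw [integral_const_mul, aux_val, ← Real.exp_add]
    apply Real.exp_le_exp.mpr
    have e : (a ^ 2 + b ^ 2) / 2 = lam * (t ^ 2 * (1 + ρ)) := by
      rw [ha, hb, mul_pow, mul_pow, mul_pow, mul_pow, hr2, hs2]; ring
    rw [e, hK, ← mul_add]
    apply mul_le_mul_of_nonneg_left _ (by linarith)
    nlinarith
end
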